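/- arXiv:1410.3926 — 4 statements merged into one kernel-verified Lean document; each statement's English description precedes it below -/
import Mathlib

section
/- Let V = lim_{n→∞} V_n, where V_n = inf_{f∈P_n} (f(0) − a_0)/(√a_1 − √a_0)². Then 34.468305 < V < 34.4889920009. -/
/-- `P_n`: coefficient sequences of even trigonometric polynomials
`f(φ) = Σ_{k=0}^n a_k cos(kφ)` with nonnegative coefficients, `a_1 > a_0`,
which are nonnegative everywhere. -/
def LandauSet (n : ℕ) : Set (ℕ → ℝ) :=
  {a | (∀ k ≤ n, 0 ≤ a k) ∧ a 0 < a 1 ∧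
    ∀ φ : ℝ, 0 ≤ ∑ k ∈ Finset.range (n + 1), a k * Real.cos (k * φ)}

/-- The Landau ratio `(f(0) - a_0) / (√a_1 - √a_0)^2`. -/
noncomputable def landauRatio (n : ℕ) (a : ℕ → ℝ) : ℝ :=
  ((∑ k ∈ Finset.range (n + 1), a k) - a 0) /
    (Real.sqrt (a 1) - Real.sqrt (a 0)) ^ 2

/-- `V_n = inf_{f ∈ P_n} (f(0) - a_0)/(√a_1 - √a_0)^2`. -/
noncomputable def landauV (n : ℕ) : ℝ := sInf (landauRatio n '' LandauSet n)

/-! ### Autocorrelation of a coefficient list -/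

/-- The autocorrelation `Σ_i L_i L_{i+k}` of a list of integers. -/
def acorr (L : List ℤ) (k : ℕ) : ℤ := (List.zipWith (· * ·) L (L.drop k)).sum

lemma acorr_eq_zero {L : List ℤ} {k : ℕ} (h : L.length ≤ k) : acorr L k = 0 := by
  simp [acorr, List.drop_eq_nil_of_le h]

lemma acorr_cons_zero (x : ℤ) (L : List ℤ) : acorr (x :: L) 0 = x ^ 2 + acorr L 0 := by
  simp [acorr, sq]

lemma acorr_cons_succ (x : ℤ) (L : List ℤ) (k : ℕ) :
    acorr (x :: L) (k + 1) = x * L.getD k 0 + acorr L (k + 1) := by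
  rcases lt_or_ge k L.length with h | h
  · rw [acorr, List.drop_succ_cons, List.drop_eq_getElem_cons h, List.zipWith_cons_cons,
      List.sum_cons, List.getD_eq_getElem L 0 h, acorr]
  · simp [acorr, List.drop_eq_nil_of_le h, List.drop_eq_nil_of_le (h.trans k.le_succ),
      List.getElem?_eq_none h]

/-- The Fourier cosine coefficients of `|Σ_j L_j e^{ijφ}|²`. -/
def sqCoeff (L : List ℤ) (k : ℕ) : ℤ := if k = 0 then acorr L 0 else 2 * acorr L k

lemma sum_acorr_cos (L : List ℤ) (m : ℕ) (hm : L.length ≤ m) (φ : ℝ) :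
    (acorr L 0 : ℝ) + 2 * ∑ k ∈ Finset.range m, (acorr L (k + 1) : ℝ) * Real.cos ((k + 1 : ℕ) * φ) =
      (∑ k ∈ Finset.range m, (L.getD k 0 : ℝ) * Real.cos (k * φ)) ^ 2 +
        (∑ k ∈ Finset.range m, (L.getD k 0 : ℝ) * Real.sin (k * φ)) ^ 2 := by
  induction L generalizing m with
  | nil => simp [acorr]
  | cons x t ih =>
    obtain ⟨m, rfl⟩ : ∃ m', m = m' + 1 := ⟨m - 1, by simp at hm; omega⟩
    have hm' : t.length ≤ m := by simpa using hm
    have key := ih m hm'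
    have hlast : acorr t (m + 1) = 0 := acorr_eq_zero (by omega)
    have hget : t.getD m 0 = 0 := by simp [List.getElem?_eq_none hm']
    have h1 : ∑ k ∈ Finset.range (m + 1),
        (acorr (x :: t) (k + 1) : ℝ) * Real.cos ((k + 1 : ℕ) * φ) =
        x * (∑ k ∈ Finset.range m, (t.getD k 0 : ℝ) * Real.cos ((k + 1 : ℕ) * φ)) +
          ∑ k ∈ Finset.range m, (acorr t (k + 1) : ℝ) * Real.cos ((k + 1 : ℕ) * φ) := by
      rw [Finset.sum_range_succ, acorr_cons_succ, hlast, hget, Finset.mul_sum,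
        ← Finset.sum_add_distrib]
      simp only [acorr_cons_succ]
      push_cast
      simp only [mul_zero, add_zero, zero_mul]
      exact Finset.sum_congr rfl fun k _ => by ring
    have h2 : ∑ k ∈ Finset.range m, (t.getD k 0 : ℝ) * Real.cos ((k + 1 : ℕ) * φ) =
        (∑ k ∈ Finset.range m, (t.getD k 0 : ℝ) * Real.cos (k * φ)) * Real.cos φ -
        (∑ k ∈ Finset.range m, (t.getD k 0 : ℝ) * Real.sin (k * φ)) * Real.sin φ := by
      rw [Finset.sum_mul, Finset.sum_mul, ← Finset.sum_sub_distrib]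
      refine Finset.sum_congr rfl fun k _ => ?_
      rw [Nat.cast_succ, add_mul, one_mul, Real.cos_add]
      ring
    have h3 : ∑ k ∈ Finset.range m, (t.getD k 0 : ℝ) * Real.sin ((k + 1 : ℕ) * φ) =
        (∑ k ∈ Finset.range m, (t.getD k 0 : ℝ) * Real.sin (k * φ)) * Real.cos φ +
        (∑ k ∈ Finset.range m, (t.getD k 0 : ℝ) * Real.cos (k * φ)) * Real.sin φ := by
      rw [Finset.sum_mul, Finset.sum_mul, ← Finset.sum_add_distrib]
      refine Finset.sum_congr rfl fun k _ => ?_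
      rw [Nat.cast_succ, add_mul, one_mul, Real.sin_add]
      ring
    rw [h1, Finset.sum_range_succ', Finset.sum_range_succ', acorr_cons_zero]
    simp only [List.getD_cons_succ, List.getD_cons_zero, Nat.cast_zero, zero_mul, Real.cos_zero,
      Real.sin_zero, mul_one, mul_zero, add_zero]
    rw [h2, h3]
    push_cast at key ⊢
    linear_combination key +
      (-(∑ k ∈ Finset.range m, (t.getD k 0 : ℝ) * Real.cos (k * φ)) ^ 2 -
        (∑ k ∈ Finset.range m, (t.getD k 0 : ℝ) * Real.sin (k * φ)) ^ 2) *
        Real.sin_sq_add_cos_sq φ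

lemma sum_sqCoeff_cos_nonneg (L : List ℤ) (m : ℕ) (hm : L.length ≤ m) (φ : ℝ) :
    0 ≤ ∑ k ∈ Finset.range (m + 1), (sqCoeff L k : ℝ) * Real.cos (k * φ) := by
  have h : ∑ k ∈ Finset.range (m + 1), (sqCoeff L k : ℝ) * Real.cos (k * φ) =
      (acorr L 0 : ℝ) +
        2 * ∑ k ∈ Finset.range m, (acorr L (k + 1) : ℝ) * Real.cos ((k + 1 : ℕ) * φ) := by
    rw [Finset.sum_range_succ', Finset.mul_sum, add_comm]
    simp [sqCoeff, mul_assoc]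
  rw [h, sum_acorr_cos L m hm]
  positivity

/-! ### Duality -/

lemma integral_cos_nat_mul {k : ℕ} (hk : k ≠ 0) :
    ∫ φ in (0 : ℝ)..2 * Real.pi, Real.cos (k * φ) = 0 := by
  have hk' : (k : ℝ) ≠ 0 := by exact_mod_cast hk
  rw [intervalIntegral.integral_comp_mul_left _ hk', integral_cos]
  simp [show Real.sin (k * (2 * Real.pi)) = 0 by
    simpa [mul_assoc] using Real.sin_nat_mul_pi (k * 2)]

lemma integral_cos_mul_cos (j k : ℕ) :
    ∫ φ in (0 : ℝ)..2 * Real.pi, Real.cos (j * φ) * Real.cos (k * φ) =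
      if j = k then (if k = 0 then 2 * Real.pi else Real.pi) else 0 := by
  wlog h : k ≤ j generalizing j k
  · have := this k j (by omega)
    simp only [mul_comm (Real.cos (j * _))]
    rw [this]
    split_ifs <;> first | rfl | omega
  have hprod (φ : ℝ) : Real.cos (j * φ) * Real.cos (k * φ) =
      (Real.cos ((j - k : ℕ) * φ) + Real.cos ((j + k : ℕ) * φ)) / 2 := by
    rw [Nat.cast_sub h, Nat.cast_add, sub_mul, add_mul, Real.cos_sub, Real.cos_add]
    ring
  have hint (i : ℕ) : IntervalIntegrable (fun φ : ℝ => Real.cos (i * φ)) MeasureTheory.volume 0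
      (2 * Real.pi) := Continuous.intervalIntegrable (by fun_prop) _ _
  simp only [hprod]
  rw [intervalIntegral.integral_div, intervalIntegral.integral_add (hint _) (hint _)]
  rcases eq_or_ne j k with rfl | hjk
  · rcases eq_or_ne j 0 with rfl | hj
    · simp
    · rw [integral_cos_nat_mul (k := j + j) (by omega)]
      simp [hj]
  · rw [integral_cos_nat_mul (k := j - k) (by omega), integral_cos_nat_mul (k := j + k) (by omega)]
    simp [hjk]

/-- A nonnegative cosine polynomial pairs nonnegatively with every autocorrelation sequence. -/
lemma sum_mul_acorr_nonneg (L : List ℤ) {n : ℕ} {a : ℕ → ℝ}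
    (ha : ∀ φ : ℝ, 0 ≤ ∑ k ∈ Finset.range (n + 1), a k * Real.cos (k * φ)) :
    0 ≤ ∑ k ∈ Finset.range (n + 1), a k * acorr L k := by
  set m := max n L.length
  have hint : 0 ≤ ∫ φ in (0 : ℝ)..2 * Real.pi,
      (∑ k ∈ Finset.range (n + 1), a k * Real.cos (k * φ)) *
        ∑ j ∈ Finset.range (m + 1), (sqCoeff L j : ℝ) * Real.cos (j * φ) :=
    intervalIntegral.integral_nonneg (by positivity) fun φ _ =>
      mul_nonneg (ha φ) (sum_sqCoeff_cos_nonneg L m (le_max_right _ _) φ)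
  have hval : ∫ φ in (0 : ℝ)..2 * Real.pi,
      (∑ k ∈ Finset.range (n + 1), a k * Real.cos (k * φ)) *
        ∑ j ∈ Finset.range (m + 1), (sqCoeff L j : ℝ) * Real.cos (j * φ) =
      2 * Real.pi * ∑ k ∈ Finset.range (n + 1), a k * acorr L k := by
    simp only [Finset.sum_mul_sum]
    rw [intervalIntegral.integral_finsetSum
      fun k _ => Continuous.intervalIntegrable (by fun_prop) _ _, Finset.mul_sum]
    refine Finset.sum_congr rfl fun k hk => ?_
    rw [intervalIntegral.integral_finsetSum
      fun j _ => Continuous.intervalIntegrable (by fun_prop) _ _]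
    have hterm (j : ℕ) : ∫ φ in (0 : ℝ)..2 * Real.pi,
        a k * Real.cos (k * φ) * ((sqCoeff L j : ℝ) * Real.cos (j * φ)) =
        if k = j then 2 * Real.pi * (a k * acorr L k) else 0 := by
      have hcomm (φ : ℝ) : a k * Real.cos (k * φ) * ((sqCoeff L j : ℝ) * Real.cos (j * φ)) =
          a k * sqCoeff L j * (Real.cos (k * φ) * Real.cos (j * φ)) := by ring
      simp only [hcomm]
      rw [intervalIntegral.integral_const_mul, integral_cos_mul_cos]
      rcases eq_or_ne k j with rfl | hkj
      · rcases eq_or_ne k 0 with rfl | hk0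
        · simp [sqCoeff]; ring
        · simp [sqCoeff, hk0]; ring
      · simp [hkj]
    simp only [hterm]
    rw [Finset.sum_ite_eq, if_pos]
    have := le_max_left n L.length
    simp only [Finset.mem_range] at hk ⊢
    omega
  rw [hval] at hint
  exact nonneg_of_mul_nonneg_right hint (by positivity)

/-- Every integer list whose autocorrelations of index at least two are at most `D` yields a
linear lower bound for `f(0) - a_0`. -/
lemma dual_bound (L : List ℤ) (D : ℤ) (hL : ∀ k < L.length, 2 ≤ k → acorr L k ≤ D)
    (hD : 0 ≤ D) {n : ℕ} (hn : 1 ≤ n) {a : ℕ → ℝ} (ha : a ∈ LandauSet n) :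
    ((D - acorr L 1 : ℤ) : ℝ) * a 1 - (acorr L 0 : ℝ) * a 0 ≤
      D * ((∑ k ∈ Finset.range (n + 1), a k) - a 0) := by
  obtain ⟨hnn, -, hpos⟩ := ha
  have h := sum_mul_acorr_nonneg L hpos
  obtain ⟨n, rfl⟩ : ∃ n', n = n' + 1 := ⟨n - 1, by omega⟩
  rw [Finset.sum_range_succ', Finset.sum_range_succ'] at h ⊢
  have htail : ∑ k ∈ Finset.range n, a (k + 1 + 1) * acorr L (k + 1 + 1) ≤
      D * ∑ k ∈ Finset.range n, a (k + 1 + 1) := by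
    rw [Finset.mul_sum]
    refine Finset.sum_le_sum fun k hk => ?_
    rw [mul_comm]
    refine mul_le_mul_of_nonneg_right ?_ (hnn _ (by simp at hk; omega))
    rcases lt_or_ge (k + 1 + 1) L.length with hk' | hk'
    · exact_mod_cast hL _ hk' (by omega)
    · rw [acorr_eq_zero hk']
      exact_mod_cast hD
  push_cast
  simp only [zero_add] at h ⊢
  linarith

/-! ### The certificates -/

/-- Coefficients of a polynomial `p` such that `|p(e^{iφ})|²` is a nearly extremal element of `P_40`. -/
def extremalFactor : List ℤ :=
  [285285, 1328805, 3093034, 4526213, 4344532, 2503696, 436424, -460683, -213250, 176131, 133876,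
   -65196, -65004, 41047, 38358, -28887, -23481, 22664, 16392, -16446, -9765, 13129, 6349, -9960,
   -2904, 8047, 789, -6036, 1024, 4497, -2318, -2671, 2792, 1082, -2557, 608, 1362, -1288, 484,
   -51, 14]

/-- Coefficients of a polynomial `q` such that `|q(e^{iφ})|²` is a dual certificate for
`√(a_0/a_1)` between `0` and `13/20`. -/
def dualFactorA : List ℤ :=
  [7, -7]

/-- Coefficients of a polynomial `q` such that `|q(e^{iφ})|²` is a dual certificate for
`√(a_0/a_1)` between `13/20` and `3/4`. -/
def dualFactorB : List ℤ :=
  [480898, -1643770, 2465101, -1723968, 42515, 711428, -209581, -119062, -290379, 456213, -73710,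
   22507, -408927, 346176, 81006, 61438, -533829, 306321, 257106, -20184, -597032, 343107, 358858,
   -182550, -518280, 389849, 340537, -421910, -31189, 7628, 286261, 14521, -538431, 319425,
   338055, -406690, -91224, 328652, -119290, -66379, 45857]

/-- Coefficients of a polynomial `q` such that `|q(e^{iφ})|²` is a dual certificate for
`√(a_0/a_1)` between `3/4` and `379/500`. -/
def dualFactorC : List ℤ :=
  [357166, -1220954, 1970900, -1682963, 449723, 476897, -313014, -257379, 252967, 130349, -115809,
   -233521, 242635, 35740, 53777, -462856, 429415, 96878, -264075, -191161, 413601, 73038,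
   -490398, 135497, 380524, -180883, -405246, 463205, -52720, -23299, -313624, 325553, 175542,
   -466823, 115265, 341594, -287901, -106507, 308336, -203320, 50921]

/-- Coefficients of a polynomial `q` such that `|q(e^{iφ})|²` is a dual certificate for
`√(a_0/a_1)` between `379/500` and `153/200`. -/
def dualFactorD : List ℤ :=
  [326004, -1116685, 1842112, -1656727, 549880, 393501, -335154, -249944, 378116, -30806, -38429,
   -324957, 444982, -68138, -180428, -85167, 294171, 58178, -461742, 229554, 261628, -153693,
   -430608, 522271, 112000, -586761, 318520, 103065, 23143, -383143, 260451, 236216, -375541,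
   -23941, 362448, -210088, -159355, 301480, -186418, 49886, -2809]

/-- Coefficients of a polynomial `q` such that `|q(e^{iφ})|²` is a dual certificate for
`√(a_0/a_1)` between `153/200` and `79/100`. -/
def dualFactorE : List ℤ :=
  [403968, -1362551, 2026356, -1429008, 49935, 553861, 81471, -713327, 338033, 373752, -340445,
   -231501, 379689, 37371, -338872, 228348, -42301]

/-- Coefficients of a polynomial `q` such that `|q(e^{iφ})|²` is a dual certificate for
`√(a_0/a_1)` between `79/100` and `9/10`. -/
def dualFactorF : List ℤ :=
  [259367, -804667, 1249544, -1119629, 397218, 359633, -553253, 130792, 401107, -555263, 322709,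
   -51348, -29140]

lemma lower_bound {n : ℕ} (hn : 1 ≤ n) {a : ℕ → ℝ} (ha : a ∈ LandauSet n) :
    34.4684 * (Real.sqrt (a 1) - Real.sqrt (a 0)) ^ 2 ≤
      (∑ k ∈ Finset.range (n + 1), a k) - a 0 := by
  have hu2 := Real.sq_sqrt (ha.1 0 (by omega))
  have hv2 := Real.sq_sqrt (ha.1 1 hn)
  have h0 : 0 * √(a 1) ≤ √(a 0) := by simp
  have h7 : √(a 0) ≤ √(a 1) := Real.sqrt_le_sqrt ha.2.1.le
  have hv := Real.sqrt_nonneg (a 1)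
  set S := (∑ k ∈ Finset.range (n + 1), a k) - a 0
  set u := √(a 0)
  set v := √(a 1)
  rcases le_total u (13/20 * v) with h1 | h1
  · have h := dual_bound (n := n) dualFactorA 1 (by decide +kernel) (by norm_num) hn ha
    rw [show acorr dualFactorA 0 = 98 by decide +kernel,
      show acorr dualFactorA 1 = -49 by decide +kernel] at h
    push_cast at h
    rw [← hu2, ← hv2] at h
    nlinarith [mul_nonneg (sub_nonneg.2 h0) (sub_nonneg.2 h1),
      mul_nonneg (sub_nonneg.2 h0) hv, mul_nonneg (sub_nonneg.2 h1) hv]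
  rcases le_total u (3/4 * v) with h2 | h2
  · have h := dual_bound (n := n) dualFactorB 1000000000000 (by decide +kernel) (by norm_num) hn ha
    rw [show acorr dualFactorB 0 = 15831892691516 by decide +kernel,
      show acorr dualFactorB 1 = -10103975413001 by decide +kernel] at h
    push_cast at h
    rw [← hu2, ← hv2] at h
    nlinarith [mul_nonneg (sub_nonneg.2 h1) (sub_nonneg.2 h2),
      mul_nonneg (sub_nonneg.2 h1) hv, mul_nonneg (sub_nonneg.2 h2) hv]
  rcases le_total u (379/500 * v) with h3 | h3
  · have h := dual_bound (n := n) dualFactorC 1000000000000 (by decide +kernel) (by norm_num) hn ha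
    rw [show acorr dualFactorC 0 = 11466437457364 by decide +kernel,
      show acorr dualFactorC 1 = -7607509931357 by decide +kernel] at h
    push_cast at h
    rw [← hu2, ← hv2] at h
    nlinarith [mul_nonneg (sub_nonneg.2 h2) (sub_nonneg.2 h3),
      mul_nonneg (sub_nonneg.2 h2) hv, mul_nonneg (sub_nonneg.2 h3) hv]
  rcases le_total u (153/200 * v) with h4 | h4
  · have h := dual_bound (n := n) dualFactorD 1000000000000 (by decide +kernel) (by norm_num) hn ha
    rw [show acorr dualFactorD 0 = 10733452052070 by decide +kernel,
      show acorr dualFactorD 1 = -7185907474784 by decide +kernel] at h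
    push_cast at h
    rw [← hu2, ← hv2] at h
    nlinarith [mul_nonneg (sub_nonneg.2 h3) (sub_nonneg.2 h4),
      mul_nonneg (sub_nonneg.2 h3) hv, mul_nonneg (sub_nonneg.2 h4) hv]
  rcases le_total u (79/100 * v) with h5 | h5
  · have h := dual_bound (n := n) dualFactorE 1000000000000 (by decide +kernel) (by norm_num) hn ha
    rw [show acorr dualFactorE 0 = 9730425441811 by decide +kernel,
      show acorr dualFactorE 1 = -6600440952259 by decide +kernel] at h
    push_cast at h
    rw [← hu2, ← hv2] at h
    nlinarith [mul_nonneg (sub_nonneg.2 h4) (sub_nonneg.2 h5),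
      mul_nonneg (sub_nonneg.2 h4) hv, mul_nonneg (sub_nonneg.2 h5) hv]
  rcases le_total u (9/10 * v) with h6 | h6
  · have h := dual_bound (n := n) dualFactorF 1000000000000 (by decide +kernel) (by norm_num) hn ha
    rw [show acorr dualFactorF 0 = 4716833670644 by decide +kernel,
      show acorr dualFactorF 1 = -3550930618342 by decide +kernel] at h
    push_cast at h
    rw [← hu2, ← hv2] at h
    nlinarith [mul_nonneg (sub_nonneg.2 h5) (sub_nonneg.2 h6),
      mul_nonneg (sub_nonneg.2 h5) hv, mul_nonneg (sub_nonneg.2 h6) hv]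
  · have h := dual_bound [] 1 (by simp) (by simp) hn ha
    simp only [acorr, List.drop_nil, List.zipWith_nil_left, List.sum_nil] at h
    push_cast at h
    rw [← hv2] at h
    nlinarith [mul_nonneg (sub_nonneg.2 h6) (sub_nonneg.2 h7),
      mul_nonneg (sub_nonneg.2 h6) hv, mul_nonneg (sub_nonneg.2 h7) hv]

lemma sqrt_sub_sqrt_sq_pos {n : ℕ} {a : ℕ → ℝ} (ha : a ∈ LandauSet n) :
    0 < (Real.sqrt (a 1) - Real.sqrt (a 0)) ^ 2 :=
  pow_pos (sub_pos.2 (Real.sqrt_lt_sqrt (ha.1 0 n.zero_le) ha.2.1)) 2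

lemma le_landauRatio {n : ℕ} (hn : 1 ≤ n) {a : ℕ → ℝ} (ha : a ∈ LandauSet n) :
    34.4684 ≤ landauRatio n a :=
  (le_div_iff₀ (sqrt_sub_sqrt_sq_pos ha)).2 (lower_bound hn ha)

lemma bddBelow_landauRatio {n : ℕ} (hn : 1 ≤ n) :
    BddBelow (landauRatio n '' LandauSet n) :=
  ⟨34.4684, by rintro _ ⟨a, ha, rfl⟩; exact le_landauRatio hn ha⟩

lemma extremal_mem : (fun k => (sqCoeff extremalFactor k : ℝ)) ∈ LandauSet 41 := by
  refine ⟨fun k hk => ?_, ?_, fun φ => ?_⟩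
  · have h : ∀ k ≤ 41, 0 ≤ sqCoeff extremalFactor k := by decide +kernel
    exact Int.cast_nonneg (h k hk)
  · have h : sqCoeff extremalFactor 0 < sqCoeff extremalFactor 1 := by decide +kernel
    exact Int.cast_lt.2 h
  · exact sum_sqCoeff_cos_nonneg extremalFactor 41 (by decide) φ

lemma landauRatio_extremal_le :
    landauRatio 41 (fun k => (sqCoeff extremalFactor k : ℝ)) ≤ 34.4889 := by
  rw [landauRatio, div_le_iff₀ (sqrt_sub_sqrt_sq_pos extremal_mem), ← Int.cast_sum,
    show ∑ k ∈ Finset.range (41 + 1), sqCoeff extremalFactor k = 258442180842769 by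
      decide +kernel,
    show sqCoeff extremalFactor 0 = 57555782631329 by decide +kernel,
    show sqCoeff extremalFactor 1 = 100000004827874 by decide +kernel]
  push_cast
  have h0 : √(57555782631329 : ℝ) ≤ 7586553 := Real.sqrt_le_iff.2 (by norm_num)
  have h1 : (10000000 : ℝ) ≤ √(100000004827874) := Real.le_sqrt_of_sq_le (by norm_num)
  have h2 : (10000000 - 7586553 : ℝ) ^ 2 ≤ (√(100000004827874) - √57555782631329) ^ 2 :=
    pow_le_pow_left₀ (by norm_num) (by linarith) 2
  linarith

/-! ### Monotonicity of `V_n` and the limit -/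

/-- Padding a coefficient sequence by zeros beyond degree `n`. -/
lemma exists_pad {m n : ℕ} (hn : 1 ≤ n) (hmn : n ≤ m) {a : ℕ → ℝ} (ha : a ∈ LandauSet n) :
    ∃ b ∈ LandauSet m, landauRatio m b = landauRatio n a := by
  have hsum (w : ℕ → ℝ) : ∑ k ∈ Finset.range (m + 1), (if k ≤ n then a k else 0) * w k =
      ∑ k ∈ Finset.range (n + 1), a k * w k := by
    rw [← Finset.sum_subset (Finset.range_mono (by omega : n + 1 ≤ m + 1))]
    · exact Finset.sum_congr rfl fun k hk => by
        rw [if_pos (Nat.lt_succ_iff.1 (Finset.mem_range.1 hk))]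
    · intro k _ hk
      rw [if_neg (by simpa using hk), zero_mul]
  refine ⟨fun k => if k ≤ n then a k else 0, ⟨fun k _ => ?_, ?_, fun φ => ?_⟩, ?_⟩
  · dsimp only
    split_ifs with h
    exacts [ha.1 k h, le_rfl]
  · simpa [hn] using ha.2.1
  · rw [hsum fun k => Real.cos (k * φ)]
    exact ha.2.2 φ
  · have := hsum fun _ => 1
    simp only [mul_one] at this
    simp [landauRatio, this, hn]

lemma landauSet_nonempty {n : ℕ} (hn : 41 ≤ n) : (LandauSet n).Nonempty :=
  let ⟨b, hb, _⟩ := exists_pad (by norm_num) hn extremal_mem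
  ⟨b, hb⟩

lemma landauV_le_of_le {m n : ℕ} (hn : 41 ≤ n) (hmn : n ≤ m) : landauV m ≤ landauV n := by
  refine csInf_le_csInf (bddBelow_landauRatio (by omega)) ((landauSet_nonempty hn).image _) ?_
  rintro _ ⟨a, ha, rfl⟩
  exact exists_pad (by omega) hmn ha

lemma le_landauV {n : ℕ} (hn : 41 ≤ n) : 34.4684 ≤ landauV n :=
  le_csInf ((landauSet_nonempty hn).image _) <| by
    rintro _ ⟨a, ha, rfl⟩
    exact le_landauRatio (by omega) ha

lemma landauV_le : landauV 41 ≤ 34.4889 :=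
  (csInf_le (bddBelow_landauRatio (by norm_num)) ⟨_, extremal_mem, rfl⟩).trans
    landauRatio_extremal_le

/-- With `V = lim_{n → ∞} V_n`, we have `34.468305 < V < 34.4889920009`. -/
theorem landau_V_bounds :
    ∃ V : ℝ, Filter.Tendsto landauV Filter.atTop (nhds V) ∧
      34.468305 < V ∧ V < 34.4889920009 := by
  have hanti : Antitone fun n => landauV (n + 41) := fun m n hmn =>
    landauV_le_of_le (by omega) (by omega)
  have hbdd : BddBelow (Set.range fun n => landauV (n + 41)) :=
    ⟨34.4684, by rintro _ ⟨n, rfl⟩; exact le_landauV (by omega)⟩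
  refine ⟨⨅ n, landauV (n + 41),
    (Filter.tendsto_add_atTop_iff_nat 41).1 (tendsto_atTop_ciInf hanti hbdd), ?_, ?_⟩
  · have : 34.4684 ≤ ⨅ n, landauV (n + 41) := le_ciInf fun n => le_landauV (by omega)
    linarith
  · have : ⨅ n, landauV (n + 41) ≤ landauV (0 + 41) := ciInf_le hbdd 0
    rw [zero_add] at this
    linarith [landauV_le]
end

section
/- There exists f ∈ P_40, i.e. an even trigonometric polynomial f(φ) = Σ_{k=0}^{40} a_k cos(kφ) of degree 40 with all a_k ≥ 0, a_1 > a_0 > 0, and f(φ) ≥ 0 for all real φ, such that (f(0) − a_0)/(√a_1 − √a_0)² < 34.488992000856. Consequently V_40 < 34.488992000856. -/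
/-- The `k`-th cosine coefficient of `|∑_{m<N} c_m e^{imφ}|²`. -/
def fejerCoeff (c : ℕ → ℤ) (N k : ℕ) : ℤ :=
  (if k = 0 then 1 else 2) * ∑ i ∈ Finset.range (N - k), c i * c (i + k)

theorem fejerCoeff_succ (c : ℕ → ℤ) {N k : ℕ} (hk : k ≤ N) :
    fejerCoeff c (N + 1) k =
      fejerCoeff c N k + (if k = 0 then 1 else 2) * (c (N - k) * c N) := by
  unfold fejerCoeff
  rw [Nat.succ_sub hk, Finset.sum_range_succ, Nat.sub_add_cancel hk, mul_add]

theorem fejerCoeff_self (c : ℕ → ℤ) (N : ℕ) : fejerCoeff c N N = 0 := by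
  simp [fejerCoeff]

/-- The Fejér–Riesz identity for real coefficients. -/
theorem sum_fejerCoeff_mul_cos (c : ℕ → ℤ) (φ : ℝ) (N : ℕ) :
    ∑ k ∈ Finset.range N, (fejerCoeff c N k : ℝ) * Real.cos (k * φ) =
      (∑ i ∈ Finset.range N, (c i : ℝ) * Real.cos (i * φ)) ^ 2 +
        (∑ i ∈ Finset.range N, (c i : ℝ) * Real.sin (i * φ)) ^ 2 := by
  induction N with
  | zero => simp
  | succ N ih =>
    have hsplit : ∑ k ∈ Finset.range (N + 1),
          (fejerCoeff c (N + 1) k : ℝ) * Real.cos (k * φ) =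
        ∑ k ∈ Finset.range (N + 1), (fejerCoeff c N k : ℝ) * Real.cos (k * φ) +
          ∑ k ∈ Finset.range (N + 1),
            (if k = 0 then 1 else 2) * ((c (N - k) : ℝ) * c N) * Real.cos (k * φ) := by
      rw [← Finset.sum_add_distrib]
      refine Finset.sum_congr rfl fun k hk => ?_
      rw [fejerCoeff_succ c (Nat.lt_succ_iff.mp (Finset.mem_range.mp hk))]
      push_cast
      ring
    have hcross : ∑ k ∈ Finset.range (N + 1),
          (if k = 0 then 1 else 2) * ((c (N - k) : ℝ) * c N) * Real.cos (k * φ) =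
        (c N : ℝ) ^ 2 + 2 * c N * ∑ i ∈ Finset.range N,
          (c i : ℝ) * (Real.cos (i * φ) * Real.cos (N * φ) +
            Real.sin (i * φ) * Real.sin (N * φ)) := by
      rw [Finset.sum_range_succ', ← Finset.sum_range_reflect, Finset.mul_sum, add_comm]
      congr 1
      · simp [sq]
      · refine Finset.sum_congr rfl fun i hi => ?_
        have hi' : i + 1 ≤ N := Finset.mem_range.mp hi
        have h1 : N - 1 - i + 1 = N - i := by omega
        have h2 : N - (N - i) = i := by omega
        have h3 : ((N - i : ℕ) : ℝ) * φ = N * φ - i * φ := by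
          rw [Nat.cast_sub (by omega)]
          ring
        rw [h1, h2, if_neg (by omega), h3, Real.cos_sub]
        ring
    have hdist : ∑ i ∈ Finset.range N,
          (c i : ℝ) * (Real.cos (i * φ) * Real.cos (N * φ) +
            Real.sin (i * φ) * Real.sin (N * φ)) =
        (∑ i ∈ Finset.range N, (c i : ℝ) * Real.cos (i * φ)) * Real.cos (N * φ) +
          (∑ i ∈ Finset.range N, (c i : ℝ) * Real.sin (i * φ)) * Real.sin (N * φ) := by
      rw [Finset.sum_mul, Finset.sum_mul, ← Finset.sum_add_distrib]
      exact Finset.sum_congr rfl fun i _ => by ring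
    rw [hsplit, hcross, hdist, Finset.sum_range_succ, fejerCoeff_self, ih,
      Finset.sum_range_succ (fun i => (c i : ℝ) * Real.cos (i * φ)),
      Finset.sum_range_succ (fun i => (c i : ℝ) * Real.sin (i * φ))]
    push_cast
    linear_combination (-(c N : ℝ) ^ 2) * Real.sin_sq_add_cos_sq (N * φ)

/-- Coefficients of the Fejér–Riesz factor of a near-optimal polynomial of degree `40`. -/
def landauFactor (i : ℕ) : ℤ :=
  [2488457, 10758836, 23595874, 32632227, 29419185, 15463404, 1708177, -3183959,
    -949298, 1326765, 672640, -538346, -311388, 337075, 174428, -232154, -97301,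
    176773, 65028, -124754, -31504, 95722, 16360, -68779, 686, 51689, -9718, -34934,
    17271, 22152, -20858, -9557, 19444, 428, -13777, 6616, 5004, -6154, 2347, -67,
    20].getD i 0

theorem fejerCoeff_landauFactor_nonneg :
    ∀ k < 41, 0 ≤ fejerCoeff landauFactor 41 k := by
  decide +kernel

theorem landauRatio_nonneg {n : ℕ} {a : ℕ → ℝ} (ha : ∀ k ≤ n, 0 ≤ a k) :
    0 ≤ landauRatio n a := by
  refine div_nonneg (sub_nonneg.mpr ?_) (sq_nonneg _)
  exact Finset.single_le_sum (f := a)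
    (fun k hk => ha k (Nat.lt_succ_iff.mp (Finset.mem_range.mp hk)))
    (Finset.mem_range.mpr n.succ_pos)

theorem landauV_le_s6 {n : ℕ} {a : ℕ → ℝ} (ha : a ∈ LandauSet n) :
    landauV n ≤ landauRatio n a := by
  refine csInf_le ⟨0, ?_⟩ (Set.mem_image_of_mem _ ha)
  rintro _ ⟨b, hb, rfl⟩
  exact landauRatio_nonneg hb.1

/-- Replacing the square roots by bounds `√a_0 ≤ s`, `t ≤ √a_1` bounds the ratio. -/
theorem landauRatio_lt {n : ℕ} {a : ℕ → ℝ} {s t r : ℝ} (hs : 0 ≤ s) (hst : s < t)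
    (h0 : a 0 ≤ s ^ 2) (h1 : t ^ 2 ≤ a 1) (hr : 0 ≤ r)
    (h : (∑ k ∈ Finset.range (n + 1), a k) - a 0 < r * (t - s) ^ 2) :
    landauRatio n a < r := by
  have hs' : Real.sqrt (a 0) ≤ s := Real.sqrt_le_iff.mpr ⟨hs, h0⟩
  have ht' : t ≤ Real.sqrt (a 1) := Real.le_sqrt_of_sq_le h1
  have hle : t - s ≤ Real.sqrt (a 1) - Real.sqrt (a 0) := by linarith
  have hpos : 0 < t - s := sub_pos.mpr hst
  unfold landauRatio
  rw [div_lt_iff₀ (pow_pos (hpos.trans_le hle) 2)]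
  exact h.trans_le (by gcongr)

theorem exists_landauRatio_lt :
    ∃ a ∈ LandauSet 40, 0 < a 0 ∧ landauRatio 40 a < 34.488992000856 := by
  refine ⟨fun k => (fejerCoeff landauFactor 41 k : ℝ), ⟨fun k hk => ?_, ?_, fun φ => ?_⟩,
    ?_, ?_⟩
  · exact Int.cast_nonneg (fejerCoeff_landauFactor_nonneg k (by omega))
  · have h : fejerCoeff landauFactor 41 0 < fejerCoeff landauFactor 41 1 := by
      decide +kernel
    exact Int.cast_lt.mpr h
  · rw [sum_fejerCoeff_mul_cos]
    positivity
  · have h : 0 < fejerCoeff landauFactor 41 0 := by decide +kernel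
    exact Int.cast_pos.mpr h
  · have h0 : fejerCoeff landauFactor 41 0 ≤ 53525822 ^ 2 := by decide +kernel
    have h1 : 70553755 ^ 2 ≤ fejerCoeff landauFactor 41 1 := by decide +kernel
    have h : ((∑ k ∈ Finset.range 41, fejerCoeff landauFactor 41 k) -
        fejerCoeff landauFactor 41 0) * 10 ^ 12 <
          34488992000856 * (70553755 - 53525822) ^ 2 := by decide +kernel
    have h' : ((∑ k ∈ Finset.range 41, (fejerCoeff landauFactor 41 k : ℝ)) -
        fejerCoeff landauFactor 41 0) * 10 ^ 12 <
          34488992000856 * (70553755 - 53525822) ^ 2 := by exact_mod_cast h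
    refine landauRatio_lt (s := 53525822) (t := 70553755) (by norm_num) (by norm_num)
      (by exact_mod_cast h0) (by exact_mod_cast h1) (by norm_num) ?_
    norm_num at h' ⊢
    linarith

/-- There is `f ∈ P_40` with `a_1 > a_0 > 0` whose Landau ratio is less than
`34.488992000856`; consequently `V_40 < 34.488992000856`. -/
theorem landau_V40 :
    (∃ a ∈ LandauSet 40, 0 < a 0 ∧ landauRatio 40 a < 34.488992000856) ∧
      landauV 40 < 34.488992000856 := by
  obtain ⟨a, ha, hpos, hlt⟩ := exists_landauRatio_lt
  exact ⟨⟨a, ha, hpos, hlt⟩, (landauV_le_s6 ha).trans_lt hlt⟩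
end

section
/- For every real y with 0 ≤ y ≤ 1.9109, one has e^y ≤ 1 + y + y²/2 + y³/3.45. -/
/-- Taylor bound for the real exponential, valid for `|x| ≤ (n + 1) / 2`. -/
theorem Real.abs_exp_sub_sum_le {x : ℝ} {n : ℕ} (hx : |x| / n.succ ≤ 1 / 2) :
    |Real.exp x - ∑ m ∈ Finset.range n, x ^ m / m.factorial| ≤
      |x| ^ n / n.factorial * 2 := by
  have h := Complex.exp_bound' (x := (x : ℂ)) (n := n)
    (by rwa [Complex.norm_real, Real.norm_eq_abs])
  rw [Complex.norm_real, Real.norm_eq_abs] at h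
  rw [← Real.norm_eq_abs, ← Complex.norm_real]
  push_cast
  exact h

/-- For `0 ≤ y ≤ 1.9109` we have `e^y ≤ 1 + y + y²/2 + y³/3.45`. -/
theorem exp_le_cubic (y : ℝ) (h0 : 0 ≤ y) (h1 : y ≤ 1.9109) :
    Real.exp y ≤ 1 + y + y ^ 2 / 2 + y ^ 3 / 3.45 := by
  have h := Real.abs_exp_sub_sum_le (x := y) (n := 14)
    (by rw [abs_of_nonneg h0]; norm_num at h1 ⊢; linarith)
  rw [abs_of_nonneg h0] at h
  replace h := (abs_le.mp h).2
  simp only [Finset.sum_range_succ, Finset.sum_range_zero, Nat.factorial] at h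
  norm_num at h
  have tail : 1 / 6 + y / 24 + y ^ 2 / 120 + y ^ 3 / 720 + y ^ 4 / 5040 + y ^ 5 / 40320
      + y ^ 6 / 362880 + y ^ 7 / 3628800 + y ^ 8 / 39916800 + y ^ 9 / 479001600
      + y ^ 10 / 6227020800 + y ^ 11 / 87178291200 * 2 ≤ 1 / 3.45 := by
    grw [h1]
    norm_num
  have cubed := mul_le_mul_of_nonneg_left tail (pow_nonneg h0 3)
  norm_num at cubed ⊢
  linarith
end

section
/- The sum Σ 1/(Im ρ)², taken over the nontrivial zeros ρ of the Riemann zeta-function with |Im ρ| ≥ 10^5, is at most 0.00027. -/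
section

open Complex MeasureTheory Set HurwitzZeta

/-- If `f` is nonnegative real, its Mellin transform on a strip is controlled by the values at the
two real points of the boundary. -/
lemma norm_mellin_le_add {f : ℝ → ℂ} (hf : ∀ t > 0, f t = (‖f t‖ : ℂ)) {a b : ℝ} {s : ℂ}
    (ha : MellinConvergent f a) (hb : MellinConvergent f b) (has : a ≤ s.re) (hsb : s.re ≤ b) :
    ‖mellin f s‖ ≤ ‖mellin f a‖ + ‖mellin f b‖ := by
  have norm_eq (z : ℂ) {t : ℝ} (ht : t ∈ Ioi 0) :
      ‖(t : ℂ) ^ (z - 1) • f t‖ = t ^ (z.re - 1) * ‖f t‖ := by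
    simp [norm_cpow_eq_rpow_re_of_pos ht]
  have norm_mellin (c : ℝ) : ∫ t in Ioi (0 : ℝ), t ^ (c - 1) * ‖f t‖ = ‖mellin f c‖ := by
    have h : mellin f c = ((∫ t in Ioi (0 : ℝ), t ^ (c - 1) * ‖f t‖ : ℝ) : ℂ) := by
      rw [mellin, ← integral_complex_ofReal]
      refine setIntegral_congr_fun measurableSet_Ioi fun t ht ↦ ?_
      simp only [smul_eq_mul]
      rw [hf t ht]
      simp [ofReal_cpow (le_of_lt ht)]
    rw [h, norm_real, Real.norm_of_nonneg]
    exact setIntegral_nonneg measurableSet_Ioi fun t ht ↦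
      mul_nonneg (Real.rpow_nonneg (le_of_lt ht) _) (norm_nonneg _)
  have integrable {c : ℝ} (hc : MellinConvergent f c) :
      IntegrableOn (fun t : ℝ ↦ t ^ (c - 1) * ‖f t‖) (Ioi 0) :=
    IntegrableOn.congr_fun hc.norm (fun t ht ↦ by simpa using norm_eq c ht) measurableSet_Ioi
  rw [← norm_mellin, ← norm_mellin, ← integral_add (integrable ha) (integrable hb)]
  refine norm_integral_le_of_norm_le ((integrable ha).add (integrable hb)) ?_
  filter_upwards [ae_restrict_mem measurableSet_Ioi] with t ht
  rw [norm_eq s ht, ← add_mul]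
  gcongr
  have ht0 : (0 : ℝ) < t := ht
  rcases le_total t 1 with h | h
  · exact (Real.rpow_le_rpow_of_exponent_ge ht0 h (by linarith)).trans
      (le_add_of_nonneg_right (by positivity))
  · exact (Real.rpow_le_rpow_of_exponent_le h (by linarith)).trans
      (le_add_of_nonneg_left (by positivity))

lemma one_le_evenKernel_zero {t : ℝ} (ht : 0 < t) : 1 ≤ evenKernel 0 t := by
  have h := hasSum_int_evenKernel₀ 0 ht
  simp only [QuotientAddGroup.mk_zero, if_true] at h
  exact sub_nonneg.mp (h.nonneg fun n ↦ by split_ifs <;> positivity)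

lemma hurwitzEvenFEPair_zero_f_modif_eq_norm {t : ℝ} (ht : 0 < t) :
    (hurwitzEvenFEPair 0).f_modif t = (‖(hurwitzEvenFEPair 0).f_modif t‖ : ℂ) := by
  suffices ∃ r : ℝ, 0 ≤ r ∧ (hurwitzEvenFEPair 0).f_modif t = r by
    obtain ⟨r, hr, h⟩ := this
    rw [h, norm_real, Real.norm_of_nonneg hr]
  rcases lt_trichotomy t 1 with h1 | rfl | h1
  · refine ⟨evenKernel 0 t - t ^ (-(1 / 2) : ℝ), ?_, ?_⟩
    · rw [evenKernel_functional_equation, ← evenKernel_eq_cosKernel_of_zero, Real.rpow_neg ht.le,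
        ← one_div, sub_nonneg]
      exact le_mul_of_one_le_right (by positivity) (one_le_evenKernel_zero (by positivity))
    · simp [WeakFEPair.f_modif, hurwitzEvenFEPair, ht, h1, not_lt.mpr h1.le]
  · exact ⟨0, le_rfl, by simp [WeakFEPair.f_modif]⟩
  · exact ⟨evenKernel 0 t - 1, sub_nonneg.mpr (one_le_evenKernel_zero ht), by
      simp [WeakFEPair.f_modif, hurwitzEvenFEPair, h1, not_lt.mpr h1.le]⟩

lemma norm_completedRiemannZeta₀_le {R : ℝ} {s : ℂ} (h₁ : -R ≤ s.re) (h₂ : s.re ≤ 1 + R) :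
    ‖completedRiemannZeta₀ s‖ ≤ 2 * ‖completedRiemannZeta₀ (1 + R)‖ := by
  have hconv (z : ℂ) : MellinConvergent (hurwitzEvenFEPair 0).f_modif z :=
    ((hurwitzEvenFEPair 0).isStrongFEPair_toStrongFEPair.hasMellin z).1
  have eq (z : ℂ) : completedRiemannZeta₀ z = mellin (hurwitzEvenFEPair 0).f_modif (z / 2) / 2 :=
    rfl
  have key := norm_mellin_le_add (s := s / 2) (a := -R / 2) (b := (1 + R) / 2)
    (fun t ht ↦ hurwitzEvenFEPair_zero_f_modif_eq_norm ht) (hconv _) (hconv _)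
    (by simp; linarith) (by simp; linarith)
  have symm : completedRiemannZeta₀ (1 + R) = completedRiemannZeta₀ (-R) := by
    rw [← completedRiemannZeta₀_one_sub]; congr 1; ring
  have e₁ : ‖completedRiemannZeta₀ (1 + R)‖ =
      ‖mellin (hurwitzEvenFEPair 0).f_modif ((-R / 2 : ℝ) : ℂ)‖ / 2 := by
    rw [symm, eq, norm_div]; push_cast; norm_num
  have e₂ : ‖completedRiemannZeta₀ (1 + R)‖ =
      ‖mellin (hurwitzEvenFEPair 0).f_modif (((1 + R) / 2 : ℝ) : ℂ)‖ / 2 := by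
    rw [eq, norm_div]; push_cast; norm_num
  rw [eq s, norm_div, RCLike.norm_ofNat]
  linarith

end

section

open Complex MeasureTheory Set HurwitzZeta

lemma Real.Gamma_le_rpow_self {x : ℝ} (hx : 2 ≤ x) : Real.Gamma x ≤ x ^ x := by
  have hx0 : 0 ≤ x := by linarith
  calc Real.Gamma x ≤ Real.Gamma (⌊x⌋₊ + 1) :=
        Real.Gamma_strictMonoOn_Ici.monotoneOn hx
          (hx.trans (Nat.lt_floor_add_one x).le) (Nat.lt_floor_add_one x).le
    _ = (⌊x⌋₊.factorial : ℝ) := Real.Gamma_nat_eq_factorial _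
    _ ≤ (⌊x⌋₊ : ℝ) ^ ⌊x⌋₊ := mod_cast Nat.factorial_le_pow _
    _ ≤ x ^ ⌊x⌋₊ := by gcongr; exact Nat.floor_le hx0
    _ = x ^ (⌊x⌋₊ : ℝ) := (Real.rpow_natCast _ _).symm
    _ ≤ x ^ x := Real.rpow_le_rpow_of_exponent_le (by linarith) (Nat.floor_le hx0)

lemma norm_riemannZeta_le_two {s : ℂ} (hs : 2 ≤ s.re) : ‖riemannZeta s‖ ≤ 2 := by
  rw [zeta_eq_tsum_one_div_nat_cpow (by linarith)]
  refine (tsum_of_norm_bounded hasSum_zeta_two fun n ↦ ?_).trans ?_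
  · rcases n.eq_zero_or_pos with rfl | hn
    · simp [zero_cpow (show s ≠ 0 by rintro rfl; norm_num at hs)]
    · rw [norm_div, norm_one, norm_natCast_cpow_of_pos hn, ← Real.rpow_natCast]
      gcongr
      · exact_mod_cast hn
      · exact_mod_cast hs
  · nlinarith [Real.pi_lt_d2, Real.pi_pos]

lemma norm_completedRiemannZeta₀_one_add_le {R : ℝ} (hR : 3 ≤ R) :
    ‖completedRiemannZeta₀ (1 + R)‖ ≤ 4 * R ^ ((1 + R) / 2) := by
  have hne : (1 + R : ℂ) ≠ 0 := by norm_cast; linarith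
  have hG : ‖Gammaℝ (1 + R)‖ ≤ R ^ ((1 + R) / 2) := by
    have e : (1 + R : ℂ) / 2 = ((1 + R) / 2 : ℝ) := by push_cast; rfl
    rw [Gammaℝ_def, norm_mul, e, Gamma_ofReal, norm_real, norm_cpow_eq_rpow_re_of_pos Real.pi_pos,
      Real.norm_of_nonneg (Real.Gamma_pos_of_pos (by linarith)).le]
    calc _ ≤ 1 * ((1 + R) / 2) ^ ((1 + R) / 2) := by
          gcongr
          · refine Real.rpow_le_one_of_one_le_of_nonpos (by linarith [Real.pi_gt_three]) ?_
            simp; linarith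
          · exact Real.Gamma_le_rpow_self (by linarith)
      _ ≤ _ := by rw [one_mul]; gcongr; linarith
  have hζ : ‖riemannZeta (1 + R)‖ ≤ 2 := norm_riemannZeta_le_two (by simp; linarith)
  have hΛ : completedRiemannZeta₀ (1 + R) =
      Gammaℝ (1 + R) * riemannZeta (1 + R) + 1 / (1 + R) + 1 / (-R) := by
    have : Gammaℝ (1 + R) ≠ 0 := Gammaℝ_ne_zero_of_re_pos (by simp; linarith)
    rw [riemannZeta_def_of_ne_zero hne, mul_div_cancel₀ _ this, completedRiemannZeta_eq]
    ring
  have h1 : (1 : ℝ) ≤ R ^ ((1 + R) / 2) := Real.one_le_rpow (by linarith) (by linarith)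
  have h2 : ‖(1 : ℂ) / (1 + R)‖ ≤ 1 := by
    rw [norm_div, norm_one, show (1 + R : ℂ) = ((1 + R : ℝ) : ℂ) by push_cast; rfl, norm_real,
      Real.norm_of_nonneg (by linarith)]
    exact (div_le_one (by linarith)).mpr (by linarith)
  have h3 : ‖(1 : ℂ) / (-R)‖ ≤ 1 := by
    rw [norm_div, norm_one, norm_neg, norm_real, Real.norm_of_nonneg (by linarith)]
    exact (div_le_one (by linarith)).mpr (by linarith)
  have h4 : ‖Gammaℝ (1 + R) * riemannZeta (1 + R)‖ ≤ R ^ ((1 + R) / 2) * 2 := by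
    rw [norm_mul]; gcongr
  rw [hΛ]
  refine (norm_add₃_le).trans ?_
  linarith

end

section

open Complex MeasureTheory Set Metric Real MeromorphicOn

/-- **Jensen's inequality** for a finite set of zeros, each counted once. -/
lemma AnalyticOnNhd.sum_posLog_le {f : ℂ → ℂ} {c : ℂ} {R M : ℝ} (hR : 0 < R) (hM : 1 ≤ M)
    (hf : AnalyticOnNhd ℂ f (closedBall c R)) (hc : f c ≠ 0)
    (hb : ∀ z ∈ sphere c R, ‖f z‖ ≤ M) (S : Finset ℂ) (hS : ∀ u ∈ S, f u = 0) :
    ∑ u ∈ S, log⁺ (R / ‖u - c‖) ≤ Real.log M - Real.log ‖f c‖ := by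
  have habs : |R| = R := abs_of_pos hR
  have jensen := AnalyticOnNhd.circleAverage_log_norm hR.ne' (by rwa [habs]) hc
  rw [habs] at jensen
  have average_le : circleAverage (fun x ↦ Real.log ‖f x‖) c R ≤ Real.log M := by
    apply circleAverage_mono_on_of_le_circle
    · have hsphere : sphere c |R| ⊆ closedBall c R := by
        rw [habs]; exact sphere_subset_closedBall
      exact (hf.mono hsphere).meromorphicOn.circleIntegrable_log_norm
    · intro z hz
      rw [habs] at hz
      obtain h | h := eq_zero_or_norm_pos (f z)
      · simpa [h] using log_nonneg hM
      · exact log_le_log h (hb z hz)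
  set D := divisor f (closedBall c R) with hD
  have supp : (fun u ↦ (D u : ℝ) * Real.log (R * ‖c - u‖⁻¹)).HasFiniteSupport :=
    (D.finiteSupport (isCompact_closedBall ..)).subset fun _ _ ↦ by simp_all
  have hterm_nonneg (u : ℂ) : 0 ≤ (D u : ℝ) * Real.log (R * ‖c - u‖⁻¹) := by
    by_cases hu : u ∈ closedBall c R
    · rcases eq_or_ne u c with rfl | huc
      · simp
      refine mul_nonneg (mod_cast hf.divisor_nonneg u) (log_nonneg ?_)
      have : 0 < ‖c - u‖ := norm_pos_iff.mpr (sub_ne_zero.mpr huc.symm)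
      rw [← div_eq_mul_inv, one_le_div this]
      simpa [dist_eq_norm'] using hu
    · simp [hD, hu]
  have hterm (u : ℂ) (hu : u ∈ S) :
      log⁺ (R / ‖u - c‖) ≤ (D u : ℝ) * Real.log (R * ‖c - u‖⁻¹) := by
    refine max_le (hterm_nonneg u) ?_
    have huc : u ≠ c := fun h ↦ hc (h ▸ hS u hu)
    have hpos : 0 < ‖u - c‖ := norm_pos_iff.mpr (sub_ne_zero.mpr huc)
    by_cases hball : u ∈ closedBall c R
    · have hlog : 0 ≤ Real.log (R / ‖u - c‖) := by
        refine log_nonneg ((one_le_div hpos).mpr ?_)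
        simpa [dist_eq_norm] using hball
      rw [norm_sub_rev c u, ← div_eq_mul_inv]
      refine le_mul_of_one_le_left hlog ?_
      have hne : analyticOrderAt f u ≠ ⊤ :=
        (hf.analyticOrderAt_ne_top_of_isPreconnected (convex_closedBall c R).isPreconnected
          (mem_closedBall_self hR.le) hball
          (by simp [(hf c (mem_closedBall_self hR.le)).analyticOrderAt_eq_zero.mpr hc]))
      have h0 : analyticOrderAt f u ≠ 0 := by
        simpa [(hf u hball).analyticOrderAt_ne_zero] using hS u hu
      rw [hD, hf.divisor_apply hball]
      lift analyticOrderAt f u to ℕ using hne with n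
      simpa [Nat.one_le_iff_ne_zero] using h0
    · refine le_trans (log_nonpos (by positivity) ((div_le_one hpos).mpr ?_)) (hterm_nonneg u)
      simp only [mem_closedBall, dist_eq_norm, not_le] at hball
      exact hball.le
  have : ∑ u ∈ S, log⁺ (R / ‖u - c‖) ≤ ∑ᶠ u, (D u : ℝ) * Real.log (R * ‖c - u‖⁻¹) := by
    rw [finsum_eq_sum_of_support_subset (s := S ∪ supp.toFinset) _ (by simp)]
    exact (Finset.sum_le_sum hterm).trans
      (Finset.sum_le_sum_of_subset_of_nonneg Finset.subset_union_left
        fun u _ _ ↦ hterm_nonneg u)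
  linarith

end

section

open MeasureTheory Set Real Filter Topology

lemma tendsto_log_div_atTop_zero : Tendsto (fun t : ℝ ↦ log t / t) atTop (𝓝 0) := by
  simpa using Real.isLittleO_log_id_atTop.tendsto_div_nhds_zero

lemma integrableOn_log_div_sq_and_integral {T : ℝ} (hT : 1 ≤ T) :
    IntegrableOn (fun t : ℝ ↦ log t / t ^ 2) (Ioi T) ∧
      ∫ t in Ioi T, log t / t ^ 2 = (log T + 1) / T := by
  have hderiv (t : ℝ) (ht : t ∈ Ici T) :
      HasDerivAt (fun t ↦ -((log t + 1) / t)) (log t / t ^ 2) t := by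
    have ht0 : t ≠ 0 := by have : T ≤ t := ht; linarith
    convert! (((hasDerivAt_log ht0).add_const 1).div (hasDerivAt_id t) ht0).neg using 1
    simp only [id]
    field
  have hnonneg (t : ℝ) (ht : t ∈ Ioi T) : 0 ≤ log t / t ^ 2 :=
    div_nonneg (log_nonneg (hT.trans (le_of_lt ht))) (sq_nonneg t)
  have hlim : Tendsto (fun t : ℝ ↦ -((log t + 1) / t)) atTop (𝓝 0) := by
    simpa [add_div] using (tendsto_log_div_atTop_zero.add tendsto_inv_atTop_zero).neg
  refine ⟨integrableOn_Ioi_deriv_of_nonneg' hderiv hnonneg hlim, ?_⟩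
  rw [integral_Ioi_of_hasDerivAt_of_nonneg' hderiv hnonneg hlim]
  ring

lemma integrableOn_posLog_div_cube_and_integral {T r : ℝ} (hT : 0 < T) (hr : T ≤ r) :
    IntegrableOn (fun t : ℝ ↦ log⁺ (t / r) / t ^ 3) (Ioi T) ∧
      ∫ t in Ioi T, log⁺ (t / r) / t ^ 3 = 1 / (4 * r ^ 2) := by
  have hr0 : 0 < r := hT.trans_le hr
  have hderiv (t : ℝ) (ht : t ∈ Ici r) :
      HasDerivAt (fun t ↦ -(log (t / r) / (2 * t ^ 2) + 1 / (4 * t ^ 2)))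
        (log (t / r) / t ^ 3) t := by
    have ht0 : t ≠ 0 := (hr0.trans_le ht).ne'
    have h1 := ((hasDerivAt_id t).div_const r).log (by simp [ht0, hr0.ne'])
    have h2 := (hasDerivAt_pow 2 t).const_mul 2
    have h3 := (hasDerivAt_pow 2 t).const_mul 4
    convert! ((h1.div h2 (by positivity)).add
      ((hasDerivAt_const t (1 : ℝ)).div h3 (by positivity))).neg using 1
    simp only [id]
    field_simp
    ring
  have hnonneg (t : ℝ) (ht : t ∈ Ioi r) : 0 ≤ log (t / r) / t ^ 3 := by
    have ht' : r < t := ht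
    have : 0 < t := hr0.trans ht'
    exact div_nonneg (log_nonneg ((one_le_div hr0).mpr ht'.le)) (by positivity)
  have hlim : Tendsto (fun t : ℝ ↦ -(log (t / r) / (2 * t ^ 2) + 1 / (4 * t ^ 2))) atTop
      (𝓝 0) := by
    have h1 : Tendsto (fun t : ℝ ↦ t / r) atTop atTop := tendsto_id.atTop_div_const hr0
    have h2 := tendsto_log_div_atTop_zero.comp h1
    have h3 := tendsto_inv_atTop_zero (𝕜 := ℝ)
    have h4 := ((h2.mul h3).const_mul (1 / (2 * r))).add ((h3.mul h3).const_mul (1 / 4))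
    have h5 := h4.neg
    simp only [mul_zero, add_zero, neg_zero] at h5
    refine h5.congr' ?_
    filter_upwards [eventually_gt_atTop 0] with t ht
    simp only [Function.comp_apply]
    field_simp
  have hind : EqOn (fun t ↦ log⁺ (t / r) / t ^ 3)
      ((Ioi r).indicator fun t ↦ log (t / r) / t ^ 3) (Ioi T) := by
    intro t ht
    have ht0 : 0 < t := hT.trans ht
    by_cases h : t ∈ Ioi r
    · rw [indicator_of_mem h]
      have : 1 ≤ |t / r| := by
        rw [abs_of_pos (by positivity)]; exact (one_le_div hr0).mpr (le_of_lt h)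
      simp only [posLog_eq_log this]
    · rw [indicator_of_notMem h]
      have : |t / r| ≤ 1 := by
        rw [abs_of_pos (by positivity)]; exact (div_le_one hr0).mpr (not_lt.mp h)
      simp only [(posLog_eq_zero_iff _).mpr this, zero_div]
  constructor
  · refine IntegrableOn.congr_fun ?_ hind.symm measurableSet_Ioi
    exact ((integrable_indicator_iff measurableSet_Ioi).mpr
      (integrableOn_Ioi_deriv_of_nonneg' hderiv hnonneg hlim)).integrableOn
  · rw [setIntegral_congr_fun measurableSet_Ioi hind, setIntegral_indicator measurableSet_Ioi,
      inter_eq_right.mpr (Ioi_subset_Ioi hr),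
      integral_Ioi_of_hasDerivAt_of_nonneg' hderiv hnonneg hlim]
    simp [hr0.ne']

/-- A bound on the integrated counting function of the radii `r i` gives a bound on the sum of
their inverse squares. -/
lemma sum_inv_sq_le_of_sum_posLog_le {ι : Type*} (S : Finset ι) (r : ι → ℝ) {T K : ℝ} (hT : 1 ≤ T)
    (hr : ∀ i ∈ S, T ≤ r i) (hK : ∀ t > T, ∑ i ∈ S, log⁺ (t / r i) ≤ K * t * log t) :
    ∑ i ∈ S, 1 / r i ^ 2 ≤ 4 * K * ((log T + 1) / T) := by
  have hT0 : 0 < T := by linarith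
  obtain ⟨hint, hval⟩ := integrableOn_log_div_sq_and_integral hT
  have hpos (i) (hi : i ∈ S) := integrableOn_posLog_div_cube_and_integral hT0 (hr i hi)
  calc ∑ i ∈ S, 1 / r i ^ 2 = 4 * ∑ i ∈ S, ∫ t in Ioi T, log⁺ (t / r i) / t ^ 3 := by
        rw [Finset.mul_sum]
        refine Finset.sum_congr rfl fun i hi ↦ ?_
        rw [(hpos i hi).2]
        have : r i ≠ 0 := (hT0.trans_le (hr i hi)).ne'
        field
    _ = 4 * ∫ t in Ioi T, ∑ i ∈ S, log⁺ (t / r i) / t ^ 3 := by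
        rw [integral_finsetSum _ fun i hi ↦ (hpos i hi).1]
    _ ≤ 4 * ∫ t in Ioi T, K * (log t / t ^ 2) := by
        refine mul_le_mul_of_nonneg_left ?_ (by norm_num)
        refine setIntegral_mono_on (integrable_finsetSum _ fun i hi ↦ (hpos i hi).1)
          (hint.const_mul K) measurableSet_Ioi fun t ht ↦ ?_
        have ht0 : 0 < t := hT0.trans ht
        rw [← Finset.sum_div, div_le_iff₀ (by positivity)]
        refine (hK t ht).trans_eq ?_
        field
    _ = 4 * K * ((log T + 1) / T) := by rw [integral_const_mul, hval]; ring

end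

open Complex

lemma norm_one_sub_mul_completedRiemannZeta₀_le {t : ℝ} (ht : 10 ≤ t) {s : ℂ} (hs : ‖s‖ = t) :
    ‖1 - s * (1 - s) * completedRiemannZeta₀ s‖ ≤ t ^ (t / 2 + 7 / 2) := by
  have hre := abs_le.mp ((abs_re_le_norm s).trans_eq hs)
  have hΛ : ‖completedRiemannZeta₀ s‖ ≤ 2 * (4 * t ^ ((1 + t) / 2)) :=
    (norm_completedRiemannZeta₀_le hre.1 (by linarith)).trans
      (by gcongr; exact norm_completedRiemannZeta₀_one_add_le (by linarith))
  have h1s : ‖1 - s‖ ≤ 1 + t := (norm_sub_le _ _).trans_eq (by rw [norm_one, hs])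
  have h1 : (1 : ℝ) ≤ t ^ ((1 + t) / 2) := Real.one_le_rpow (by linarith) (by linarith)
  calc ‖1 - s * (1 - s) * completedRiemannZeta₀ s‖
      ≤ 1 + t * (1 + t) * (2 * (4 * t ^ ((1 + t) / 2))) := by
        refine (norm_sub_le _ _).trans ?_
        rw [norm_one, norm_mul, norm_mul, hs]
        gcongr
    _ ≤ (1 + 8 * t * (1 + t)) * t ^ ((1 + t) / 2) := by linarith
    _ ≤ t ^ 3 * t ^ ((1 + t) / 2) := by
        gcongr
        nlinarith [mul_nonneg (sub_nonneg.mpr ht) (sq_nonneg t)]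
    _ = t ^ (t / 2 + 7 / 2) := by
        rw [← Real.rpow_natCast, ← Real.rpow_add (by linarith)]
        congr 1; push_cast; ring

lemma one_sub_mul_completedRiemannZeta₀_eq_zero {s : ℂ} (hs : riemannZeta s = 0)
    (h0 : 0 < s.re) (h1 : s.re < 1) : 1 - s * (1 - s) * completedRiemannZeta₀ s = 0 := by
  have hs0 : s ≠ 0 := by rintro rfl; simp at h0
  have hs1 : 1 - s ≠ 0 := fun h ↦ by simp [← sub_eq_zero.mp h] at h1
  rw [riemannZeta_def_of_ne_zero hs0, div_eq_zero_iff,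
    or_iff_left (Gammaℝ_ne_zero_of_re_pos h0), completedRiemannZeta_eq] at hs
  field_simp at hs
  linear_combination -hs

lemma sum_posLog_zeta_zeros_le (S : Finset ℂ)
    (hS : ∀ ρ ∈ S, riemannZeta ρ = 0 ∧ 0 < ρ.re ∧ ρ.re < 1) {t : ℝ} (ht : 10 ≤ t) :
    ∑ ρ ∈ S, Real.posLog (t / ‖ρ‖) ≤ (t / 2 + 7 / 2) * Real.log t := by
  have hdiff : Differentiable ℂ fun s ↦ 1 - s * (1 - s) * completedRiemannZeta₀ s := by
    have := differentiable_completedZeta₀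
    fun_prop
  have := AnalyticOnNhd.sum_posLog_le (c := 0) (R := t) (by linarith)
    (Real.one_le_rpow (by linarith) (by linarith))
    (fun z _ ↦ hdiff.analyticAt z) (by simp)
    (fun z hz ↦ norm_one_sub_mul_completedRiemannZeta₀_le ht (by simpa using hz)) S
    fun ρ hρ ↦ one_sub_mul_completedRiemannZeta₀_eq_zero (hS ρ hρ).1 (hS ρ hρ).2.1 (hS ρ hρ).2.2
  simpa [Real.log_rpow (show 0 < t by linarith)] using this

lemma log_ten_pow_five_le : Real.log (10 ^ 5) ≤ 12 := by
  rw [Real.log_le_iff_le_exp (by positivity), show (12 : ℝ) = (12 : ℕ) * 1 by norm_num,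
    Real.exp_nat_mul]
  calc (10 : ℝ) ^ 5 ≤ 2.7 ^ 12 := by norm_num
    _ ≤ _ := by gcongr; linarith [Real.exp_one_gt_d9]

lemma one_div_im_sq_le {s : ℂ} (h0 : 0 < s.re) (h1 : s.re < 1) (h : (10 : ℝ) ^ 5 ≤ |s.im|) :
    1 / s.im ^ 2 ≤ (1 + 1 / 10 ^ 10) * (1 / ‖s‖ ^ 2) := by
  have hsq : (10 : ℝ) ^ 10 ≤ s.im ^ 2 := by
    rw [← sq_abs]
    nlinarith
  have hn : ‖s‖ ^ 2 = s.re ^ 2 + s.im ^ 2 := by rw [← normSq_eq_norm_sq, normSq_apply]; ring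
  rw [hn, mul_one_div, div_le_div_iff₀ (by positivity) (by positivity)]
  nlinarith

/-- The sum of `1/(Im ρ)²` over the nontrivial zeros `ρ` of the Riemann
zeta-function with `|Im ρ| ≥ 10^5` is at most `0.00027`. -/
theorem zeta_zero_sum_le :
    ∑' ρ : {ρ : ℂ // riemannZeta ρ = 0 ∧ 0 < ρ.re ∧ ρ.re < 1 ∧
        (10 : ℝ) ^ 5 ≤ |ρ.im|}, 1 / (ρ : ℂ).im ^ 2 ≤ 0.00027 := by
  refine Real.tsum_le_of_sum_le (fun ρ ↦ by positivity) fun S ↦ ?_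
  have key : ∑ ρ ∈ S, 1 / ‖(ρ : ℂ)‖ ^ 2 ≤
      4 * 0.501 * ((Real.log (10 ^ 5) + 1) / 10 ^ 5) := by
    refine sum_inv_sq_le_of_sum_posLog_le S (fun ρ ↦ ‖(ρ : ℂ)‖) (by norm_num)
      (fun ρ _ ↦ ρ.2.2.2.2.trans (abs_im_le_norm _)) fun t ht ↦ ?_
    have hlog : 0 ≤ Real.log t := Real.log_nonneg (by linarith)
    have h := sum_posLog_zeta_zeros_le (S.map (Function.Embedding.subtype _))
      (by
        simp only [Finset.mem_map, Function.Embedding.subtype_apply]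
        rintro _ ⟨ρ, -, rfl⟩
        exact ⟨ρ.2.1, ρ.2.2.1, ρ.2.2.2.1⟩) (show 10 ≤ t by linarith)
    rw [Finset.sum_map] at h
    refine h.trans ?_
    gcongr
    linarith
  calc ∑ ρ ∈ S, 1 / (ρ : ℂ).im ^ 2
      ≤ ∑ ρ ∈ S, (1 + 1 / 10 ^ 10) * (1 / ‖(ρ : ℂ)‖ ^ 2) :=
        Finset.sum_le_sum fun ρ _ ↦ one_div_im_sq_le ρ.2.2.1 ρ.2.2.2.1 ρ.2.2.2.2
    _ ≤ (1 + 1 / 10 ^ 10) * (4 * 0.501 * ((12 + 1) / 10 ^ 5)) := by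
        rw [← Finset.mul_sum]
        gcongr
        refine key.trans ?_
        gcongr
        exact log_ten_pow_five_le
    _ ≤ 0.00027 := by norm_num
end
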